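/- Let T > 0. There exists a constant C = C(T) > 0 such that for all times 0 < s₁ < t₁ ≤ T, 0 < s₂ < t₂ ≤ T, all η₁, η₂, η₃, η₄ ∈ (0, 2T+2], and all points y₁, y₂, z₁, z₂ ∈ ℝ³, one has ∫_{ℝ³} ∫_{ℝ³} K_{t₁−s₁}(y₁,w₁) · K_{t₂−s₂}(y₂,w₂) · K_{η₁}(z₁,w₂) · K_{η₂}(z₁,w₂) · K_{η₃}(z₂,w₁) · K_{η₄}(z₂,w₁) dw₁ dw₂ ≤ C · (t₁−s₁)^{−3/4} · (t₂−s₂)^{−3/4} · (η₁·η₂·η₃·η₄)^{−9/8}. -/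

import Mathlib

open MeasureTheory Real

noncomputable section

/-- Mehler heat kernel of the harmonic oscillator `H = -Δ + |x|²` on `ℝ³`. -/
def mehlerK (t : ℝ) (x y : EuclideanSpace ℝ (Fin 3)) : ℝ :=
  (2 * π * Real.sinh (2 * t)) ^ (-(3 : ℝ) / 2) *
    Real.exp (-‖x - y‖ ^ 2 / (4 * Real.tanh t) - Real.tanh t * ‖x + y‖ ^ 2 / 4)

lemma mehlerK_nonneg {t : ℝ} (ht : 0 < t) (x y : EuclideanSpace ℝ (Fin 3)) :
    0 ≤ mehlerK t x y := by
  have := Real.sinh_pos_iff.2 (by linarith : 0 < 2 * t)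
  unfold mehlerK
  positivity

lemma continuous_mehlerK (t : ℝ) (x : EuclideanSpace ℝ (Fin 3)) :
    Continuous (mehlerK t x) := by
  unfold mehlerK
  fun_prop

lemma tanh_le_self {t : ℝ} (ht : 0 ≤ t) : Real.tanh t ≤ t := by
  have hderiv (x : ℝ) : HasDerivAt (fun x => x * Real.cosh x - Real.sinh x)
      (x * Real.sinh x) x := by
    have h := ((hasDerivAt_id x).mul (Real.hasDerivAt_cosh x)).sub (Real.hasDerivAt_sinh x)
    exact h.congr_deriv (by simp [id])
  have hmono : MonotoneOn (fun x => x * Real.cosh x - Real.sinh x) (Set.Ici 0) := by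
    refine monotoneOn_of_deriv_nonneg (convex_Ici 0)
      (fun x _ => (hderiv x).continuousAt.continuousWithinAt)
      (fun x _ => (hderiv x).differentiableAt.differentiableWithinAt) fun x hx => ?_
    rw [interior_Ici, Set.mem_Ioi] at hx
    rw [(hderiv x).deriv]
    exact mul_nonneg hx.le (Real.sinh_nonneg_iff.2 hx.le)
  have h := hmono (Set.mem_Ici.2 le_rfl) (Set.mem_Ici.2 ht) ht
  rw [Real.tanh_eq_sinh_div_cosh, div_le_iff₀ (Real.cosh_pos t)]
  simp only [zero_mul, Real.sinh_zero, sub_zero] at h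
  linarith

/-- The Mehler kernel is dominated by a multiple of the Euclidean heat kernel. -/
lemma mehlerK_le_heat {t : ℝ} (ht : 0 < t) (x y : EuclideanSpace ℝ (Fin 3)) :
    mehlerK t x y ≤ t ^ (-(3 : ℝ) / 2) * Real.exp (-(1 / (4 * t)) * ‖y - x‖ ^ 2) := by
  have hs : 2 * t ≤ Real.sinh (2 * t) := Real.self_le_sinh_iff.2 (by linarith)
  have htanh : 0 < Real.tanh t := by
    rw [Real.tanh_eq_sinh_div_cosh]
    exact div_pos (Real.sinh_pos_iff.2 ht) (Real.cosh_pos t)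
  unfold mehlerK
  gcongr ?_ * Real.exp ?_
  · exact Real.rpow_le_rpow_of_nonpos ht (by nlinarith [Real.pi_gt_three]) (by norm_num)
  · rw [norm_sub_rev y x]
    have h1 : ‖x - y‖ ^ 2 / (4 * t) ≤ ‖x - y‖ ^ 2 / (4 * Real.tanh t) := by
      gcongr
      exact tanh_le_self ht.le
    have h2 : 0 ≤ Real.tanh t * ‖x + y‖ ^ 2 / 4 := by positivity
    have h3 : -(1 / (4 * t)) * ‖x - y‖ ^ 2 = -(‖x - y‖ ^ 2 / (4 * t)) := by ring
    rw [h3, neg_div]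
    linarith

lemma mehlerK_le_rpow {t : ℝ} (ht : 0 < t) (x y : EuclideanSpace ℝ (Fin 3)) :
    mehlerK t x y ≤ t ^ (-(3 : ℝ) / 2) := by
  refine (mehlerK_le_heat ht x y).trans (mul_le_of_le_one_right (by positivity) ?_)
  rw [Real.exp_le_one_iff, neg_mul, neg_nonpos]
  positivity

lemma integral_gaussian_shift {t : ℝ} (ht : 0 < t) (x : EuclideanSpace ℝ (Fin 3)) :
    ∫ y, Real.exp (-(1 / (4 * t)) * ‖y - x‖ ^ 2) = (4 * π * t) ^ ((3 : ℝ) / 2) := by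
  rw [integral_sub_right_eq_self
    (fun y : EuclideanSpace ℝ (Fin 3) => Real.exp (-(1 / (4 * t)) * ‖y‖ ^ 2)) x,
    GaussianFourier.integral_rexp_neg_mul_sq_norm (by positivity)]
  simp only [finrank_euclideanSpace, Fintype.card_fin, Nat.cast_ofNat]
  congr 1
  field_simp

lemma integrable_gaussian_shift {t : ℝ} (ht : 0 < t) (x : EuclideanSpace ℝ (Fin 3)) :
    Integrable (fun y => Real.exp (-(1 / (4 * t)) * ‖y - x‖ ^ 2)) := by
  by_contra h
  have h1 := integral_gaussian_shift ht x
  rw [integral_undef h] at h1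
  exact (by positivity : (0 : ℝ) < (4 * π * t) ^ ((3 : ℝ) / 2)).ne h1

lemma integrable_mehlerK {t : ℝ} (ht : 0 < t) (x : EuclideanSpace ℝ (Fin 3)) :
    Integrable (mehlerK t x) := by
  refine ((integrable_gaussian_shift ht x).const_mul (t ^ (-(3 : ℝ) / 2))).mono'
    (continuous_mehlerK t x).aestronglyMeasurable (ae_of_all _ fun y => ?_)
  rw [Real.norm_of_nonneg (mehlerK_nonneg ht x y)]
  exact mehlerK_le_heat ht x y

lemma integral_mehlerK_le {t : ℝ} (ht : 0 < t) (x : EuclideanSpace ℝ (Fin 3)) :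
    ∫ y, mehlerK t x y ≤ (4 * π) ^ ((3 : ℝ) / 2) := by
  calc ∫ y, mehlerK t x y
      ≤ ∫ y, t ^ (-(3 : ℝ) / 2) * Real.exp (-(1 / (4 * t)) * ‖y - x‖ ^ 2) :=
        integral_mono (integrable_mehlerK ht x) ((integrable_gaussian_shift ht x).const_mul _)
          (mehlerK_le_heat ht x)
    _ = (4 * π) ^ ((3 : ℝ) / 2) := by
        rw [integral_const_mul, integral_gaussian_shift ht, Real.mul_rpow (by positivity) ht.le,
          mul_left_comm, ← Real.rpow_add ht]
        norm_num

/-- In a triple product of Mehler kernels, one factor is integrated and the other two are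
bounded uniformly. -/
lemma integral_mul_mul_mehlerK_le {a b c : ℝ} (ha : 0 < a) (hb : 0 < b) (hc : 0 < c)
    (x y z : EuclideanSpace ℝ (Fin 3)) :
    ∫ w, mehlerK a x w * mehlerK b y w * mehlerK c z w ≤
      (4 * π) ^ ((3 : ℝ) / 2) * (b ^ (-(3 : ℝ) / 2) * c ^ (-(3 : ℝ) / 2)) := by
  calc ∫ w, mehlerK a x w * mehlerK b y w * mehlerK c z w
      ≤ ∫ w, mehlerK a x w * (b ^ (-(3 : ℝ) / 2) * c ^ (-(3 : ℝ) / 2)) := by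
        refine integral_mono_of_nonneg (ae_of_all _ fun w => ?_)
          ((integrable_mehlerK ha x).mul_const _) (ae_of_all _ fun w => ?_)
        · exact mul_nonneg (mul_nonneg (mehlerK_nonneg ha x w) (mehlerK_nonneg hb y w))
            (mehlerK_nonneg hc z w)
        · dsimp only
          rw [mul_assoc]
          exact mul_le_mul_of_nonneg_left
            (mul_le_mul (mehlerK_le_rpow hb y w) (mehlerK_le_rpow hc z w)
              (mehlerK_nonneg hc z w) (by positivity)) (mehlerK_nonneg ha x w)
    _ ≤ _ := by
        rw [integral_mul_const]
        exact mul_le_mul_of_nonneg_right (integral_mehlerK_le ha x) (by positivity)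

/-- Interpolation of the three bounds given by `integral_mul_mul_mehlerK_le`. -/
lemma integral_mehlerK_triple_le {a b c : ℝ} (ha : 0 < a) (hb : 0 < b) (hc : 0 < c)
    (x y z : EuclideanSpace ℝ (Fin 3)) :
    ∫ w, mehlerK a x w * mehlerK b y w * mehlerK c z w ≤
      (4 * π) ^ ((3 : ℝ) / 2) * (a ^ (-(3 : ℝ) / 4) * (b * c) ^ (-(9 : ℝ) / 8)) := by
  set J := ∫ w, mehlerK a x w * mehlerK b y w * mehlerK c z w with hJ
  set M : ℝ := (4 * π) ^ ((3 : ℝ) / 2) with hM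
  have hMpos : 0 < M := by positivity
  have hJ0 : 0 ≤ J := integral_nonneg fun w =>
    mul_nonneg (mul_nonneg (mehlerK_nonneg ha x w) (mehlerK_nonneg hb y w))
      (mehlerK_nonneg hc z w)
  have h1 : J ≤ M * (b ^ (-(3 : ℝ) / 2) * c ^ (-(3 : ℝ) / 2)) :=
    integral_mul_mul_mehlerK_le ha hb hc x y z
  have h2 : J ≤ M * (a ^ (-(3 : ℝ) / 2) * c ^ (-(3 : ℝ) / 2)) := by
    have h := integral_mul_mul_mehlerK_le hb ha hc y x z
    simpa only [mul_comm (mehlerK b y _)] using h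
  have h3 : J ≤ M * (a ^ (-(3 : ℝ) / 2) * b ^ (-(3 : ℝ) / 2)) := by
    have h := integral_mul_mul_mehlerK_le hc ha hb z x y
    have hperm (w : EuclideanSpace ℝ (Fin 3)) :
        mehlerK c z w * mehlerK a x w * mehlerK b y w =
          mehlerK a x w * mehlerK b y w * mehlerK c z w := by ring
    simpa only [hperm] using h
  have key : J ^ (4 : ℕ) ≤ (M * (a ^ (-(3 : ℝ) / 4) * (b * c) ^ (-(9 : ℝ) / 8))) ^ (4 : ℕ) := by
    calc J ^ (4 : ℕ) = J * J * J * J := by ring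
      _ ≤ (M * (b ^ (-(3 : ℝ) / 2) * c ^ (-(3 : ℝ) / 2))) *
          (M * (b ^ (-(3 : ℝ) / 2) * c ^ (-(3 : ℝ) / 2))) *
          (M * (a ^ (-(3 : ℝ) / 2) * c ^ (-(3 : ℝ) / 2))) *
          (M * (a ^ (-(3 : ℝ) / 2) * b ^ (-(3 : ℝ) / 2))) := by gcongr
      _ = M ^ 4 * ((a ^ (-(3 : ℝ) / 2)) ^ 2 * (b ^ (-(3 : ℝ) / 2)) ^ 3 *
          (c ^ (-(3 : ℝ) / 2)) ^ 3) := by ring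
      _ = _ := by
        rw [Real.mul_rpow hb.le hc.le, mul_pow, mul_pow, mul_pow]
        simp only [← Real.rpow_mul_natCast ha.le, ← Real.rpow_mul_natCast hb.le,
          ← Real.rpow_mul_natCast hc.le]
        norm_num [mul_assoc]
  exact le_of_pow_le_pow_left₀ (by norm_num) (by positivity) key

/-- a product-of-kernels integral bound (estimate on `𝒻^{1,2}`). -/
theorem kernel_product_bound_scrF12 (T : ℝ) (hT : 0 < T) :
    ∃ C : ℝ, 0 < C ∧
      ∀ t₁ t₂ s₁ s₂ η₁ η₂ η₃ η₄ : ℝ,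
        0 < s₁ → s₁ < t₁ → t₁ ≤ T → 0 < s₂ → s₂ < t₂ → t₂ ≤ T →
        0 < η₁ → η₁ ≤ 2 * T + 2 → 0 < η₂ → η₂ ≤ 2 * T + 2 →
        0 < η₃ → η₃ ≤ 2 * T + 2 → 0 < η₄ → η₄ ≤ 2 * T + 2 →
        ∀ y₁ y₂ z₁ z₂ : EuclideanSpace ℝ (Fin 3),
          (∫ w₁, ∫ w₂,
              mehlerK (t₁ - s₁) y₁ w₁ * mehlerK (t₂ - s₂) y₂ w₂ * mehlerK η₁ z₁ w₂ *
                mehlerK η₂ z₁ w₂ * mehlerK η₃ z₂ w₁ * mehlerK η₄ z₂ w₁) ≤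
            C * (t₁ - s₁) ^ (-(3 : ℝ) / 4) * (t₂ - s₂) ^ (-(3 : ℝ) / 4) *
              (η₁ * η₂ * η₃ * η₄) ^ (-(9 : ℝ) / 8) := by
  refine ⟨(4 * π) ^ ((3 : ℝ) / 2) * (4 * π) ^ ((3 : ℝ) / 2), by positivity, ?_⟩
  intro t₁ t₂ s₁ s₂ η₁ η₂ η₃ η₄ _ hst₁ _ _ hst₂ _ h₁ _ h₂ _ h₃ _ h₄ _ y₁ y₂ z₁ z₂
  have ha : 0 < t₁ - s₁ := sub_pos.2 hst₁
  have hb : 0 < t₂ - s₂ := sub_pos.2 hst₂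
  have hfactor : (∫ w₁, ∫ w₂,
      mehlerK (t₁ - s₁) y₁ w₁ * mehlerK (t₂ - s₂) y₂ w₂ * mehlerK η₁ z₁ w₂ *
        mehlerK η₂ z₁ w₂ * mehlerK η₃ z₂ w₁ * mehlerK η₄ z₂ w₁) =
      (∫ w₁, mehlerK (t₁ - s₁) y₁ w₁ * mehlerK η₃ z₂ w₁ * mehlerK η₄ z₂ w₁) *
        ∫ w₂, mehlerK (t₂ - s₂) y₂ w₂ * mehlerK η₁ z₁ w₂ * mehlerK η₂ z₁ w₂ := by
    rw [← integral_mul_const]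
    congr 1 with w₁
    rw [← integral_const_mul]
    congr 1 with w₂
    ring
  rw [hfactor]
  refine (mul_le_mul (integral_mehlerK_triple_le ha h₃ h₄ y₁ z₂ z₂)
    (integral_mehlerK_triple_le hb h₁ h₂ y₂ z₁ z₁) (integral_nonneg fun w =>
      mul_nonneg (mul_nonneg (mehlerK_nonneg hb _ w) (mehlerK_nonneg h₁ _ w))
        (mehlerK_nonneg h₂ _ w)) (by positivity)).trans_eq ?_
  rw [mul_assoc (η₁ * η₂), Real.mul_rpow (mul_pos h₁ h₂).le (mul_pos h₃ h₄).le]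
  ring

end
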